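/- There does not exist a real-linear map φ : M_2 → ℋ_2 such that φ(𝒰_2) ⊆ ℋ_2 ∩ 𝒰_2; that is, no real-linear map on the 2×2 complex matrices sends every 2×2 unitary matrix to a hermitian unitary 2×2 matrix. -/

import Mathlib

open Matrix Kronecker

/-- `Mat m` is the space of `m × m` complex matrices. -/
abbrev Mat (m : ℕ) : Type := Matrix (Fin m) (Fin m) ℂ

/-- The "real part" `(A + A*)/2` of a square complex matrix. -/
noncomputable def MRe {m : ℕ} (A : Mat m) : Mat m := (2⁻¹ : ℂ) • (A + Aᴴ)

/-- The real vector space `ℋ_m` of `m × m` complex hermitian matrices,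
as a real submodule of `Mat m`. -/
noncomputable def HermS (m : ℕ) : Submodule ℝ (Mat m) where
  carrier := {A | A.IsHermitian}
  add_mem' := fun ha hb => ha.add hb
  zero_mem' := Matrix.isHermitian_zero
  smul_mem' := fun r A hA => by
    simpa [Matrix.IsHermitian, Matrix.conjTranspose_smul] using congrArg (r • ·) hA

/-- The real vector space `ℋ_m^0` of trace-zero `m × m` complex hermitian matrices,
as a real submodule of `Mat m`. -/
noncomputable def H0S (m : ℕ) : Submodule ℝ (Mat m) where
  carrier := {A | A.IsHermitian ∧ A.trace = 0}
  add_mem' := fun ha hb => ⟨ha.1.add hb.1, by simp [Matrix.trace_add, ha.2, hb.2]⟩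
  zero_mem' := ⟨Matrix.isHermitian_zero, by simp⟩
  smul_mem' := fun r A hA => ⟨by
    simpa [Matrix.IsHermitian, Matrix.conjTranspose_smul] using congrArg (r • ·) hA.1,
    by simp [Matrix.trace_smul, hA.2]⟩

/-- Transport a square matrix along an equality of sizes. -/
def castM {a b : ℕ} (h : a = b) (A : Mat a) : Mat b :=
  Matrix.reindex (finCongr h) (finCongr h) A

/-- A `2 × 2` block matrix with blocks of sizes `a` and `b`. -/
def blks {a b : ℕ} (A : Matrix (Fin a) (Fin a) ℂ) (B : Matrix (Fin a) (Fin b) ℂ)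
    (C : Matrix (Fin b) (Fin a) ℂ) (D : Matrix (Fin b) (Fin b) ℂ) : Mat (a + b) :=
  Matrix.reindex finSumFinEquiv finSumFinEquiv (Matrix.fromBlocks A B C D)

/-- The direct (block-diagonal) sum `A ⊕ B` of square matrices. -/
def dsum {a b : ℕ} (A : Mat a) (B : Mat b) : Mat (a + b) := blks A 0 0 B

/-- The Kronecker product of complex matrices, with `Fin`-indexing. -/
def kron {a b c d : ℕ} (A : Matrix (Fin a) (Fin b) ℂ) (B : Matrix (Fin c) (Fin d) ℂ) :
    Matrix (Fin (a * c)) (Fin (b * d)) ℂ :=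
  Matrix.reindex finProdFinEquiv finProdFinEquiv (A ⊗ₖ B)

/-- Iterated direct (block-diagonal) sum `A 0 ⊕ A 1 ⊕ ⋯ ⊕ A (r-1)` of square matrices
of sizes `m 0, …, m (r-1)`. -/
def bdiag : {r : ℕ} → (m : Fin r → ℕ) → ((j : Fin r) → Mat (m j)) → Mat (∑ j, m j)
  | 0, _, _ => 0
  | _+1, m, A =>
      castM (Fin.sum_univ_succ m).symm
        (dsum (A 0) (bdiag (fun j => m j.succ) (fun j => A j.succ)))


lemma trace_zero_aux (A B : Mat 2) (hB : B * B = 1) (h : A * B + B * A = 0) : A.trace = 0 := by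
  have h1 : (A * B * B).trace = (B * (A * B)).trace := Matrix.trace_mul_comm _ _
  have h2 : A * B = -(B * A) := eq_neg_of_add_eq_zero_left h
  have h3 : B * (A * B) = -A := by rw [h2, mul_neg, ← mul_assoc, hB, one_mul]
  rw [mul_assoc, hB, mul_one, h3, Matrix.trace_neg] at h1
  exact self_eq_neg.mp h1

lemma trace_mul_zero_aux (A B : Mat 2) (h : A * B + B * A = 0) :
    (A * B).trace = 0 ∧ (B * A).trace = 0 := by
  have h1 : (A * B).trace = (B * A).trace := Matrix.trace_mul_comm _ _
  have h2 : A * B = -(B * A) := eq_neg_of_add_eq_zero_left h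
  have h3 : (A * B).trace = -(B * A).trace := by rw [h2, Matrix.trace_neg]
  rw [h1] at h3
  have h4 := self_eq_neg.mp h3
  exact ⟨h1.trans h4, h4⟩

lemma no_four (A B C D : Mat 2) (hA : A * A = 1) (hB : B * B = 1) (hC : C * C = 1)
    (hD : D * D = 1) (hAB : A * B + B * A = 0) (hAC : A * C + C * A = 0)
    (hAD : A * D + D * A = 0) (hBC : B * C + C * B = 0) (hBD : B * D + D * B = 0)
    (hCD : C * D + D * C = 0) : False := by
  have tA := trace_zero_aux A B hB hAB
  have tB := trace_zero_aux B C hC hBC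
  have tC := trace_zero_aux C D hD hCD
  have tD := trace_zero_aux D A hA (by rw [add_comm]; exact hAD)
  have ab := trace_mul_zero_aux A B hAB
  have ac := trace_mul_zero_aux A C hAC
  have ad := trace_mul_zero_aux A D hAD
  have bc := trace_mul_zero_aux B C hBC
  have bd := trace_mul_zero_aux B D hBD
  have cd := trace_mul_zero_aux C D hCD
  have li : LinearIndependent ℂ ![(1 : Mat 2), A, B, C, D] := by
    rw [Fintype.linearIndependent_iff]
    intro g hg
    simp only [Fin.sum_univ_five] at hg
    have key : ∀ X : Mat 2, (X * (g 0 • (1 : Mat 2) + g 1 • A + g 2 • B + g 3 • C + g 4 • D)).trace = 0 := by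
      intro X
      have : g 0 • (1 : Mat 2) + g 1 • A + g 2 • B + g 3 • C + g 4 • D = 0 := hg
      rw [this]; simp
    simp only [mul_add, Matrix.mul_smul, Matrix.trace_add, Matrix.trace_smul, mul_one] at key
    have k0 := key 1
    have k1 := key A
    have k2 := key B
    have k3 := key C
    have k4 := key D
    simp [tA, tB, tC, tD, hA, hB, hC, hD, ab, ac, ad, bc, bd, cd] at k0 k1 k2 k3 k4
    intro i
    fin_cases i <;> assumption
  have := li.fintype_card_le_finrank
  simp [Module.finrank_matrix] at this

lemma anti_aux (φ : Mat 2 → HermS 2) (hl : IsLinearMap ℝ φ)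
    (hsq : ∀ U : Mat 2, U * Uᴴ = 1 → (φ U : Mat 2) * (φ U : Mat 2) = 1)
    (X Y : Mat 2) (hX : X * Xᴴ = 1) (hY : Y * Yᴴ = 1) (hXY : X * Yᴴ + Y * Xᴴ = 0) :
    (φ X : Mat 2) * φ Y + (φ Y : Mat 2) * φ X = 0 := by
  have h := hsq ((3/5 : ℝ) • X + (4/5 : ℝ) • Y) (by
    have e : ((3/5 : ℝ) • X + (4/5 : ℝ) • Y) * ((3/5 : ℝ) • X + (4/5 : ℝ) • Y)ᴴ
      = (9/25 : ℝ) • (X * Xᴴ) + (16/25 : ℝ) • (Y * Yᴴ) + (12/25 : ℝ) • (X * Yᴴ + Y * Xᴴ) := by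
      simp only [Matrix.conjTranspose_add, Matrix.conjTranspose_smul, star_trivial, add_mul,
        mul_add, Matrix.smul_mul, Matrix.mul_smul]
      module
    rw [e, hX, hY, hXY]
    module)
  have hx := hsq X hX
  have hy := hsq Y hY
  rw [hl.map_add, hl.map_smul, hl.map_smul] at h
  simp only [Submodule.coe_add, Submodule.coe_smul] at h
  generalize (φ X : Mat 2) = A at *
  generalize (φ Y : Mat 2) = B at *
  have e : ((3/5 : ℝ) • A + (4/5 : ℝ) • B) * ((3/5 : ℝ) • A + (4/5 : ℝ) • B)
      = (9/25 : ℝ) • (A * A) + (16/25 : ℝ) • (B * B) + (12/25 : ℝ) • (A * B + B * A) := by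
    simp only [add_mul, mul_add, Matrix.smul_mul, Matrix.mul_smul]
    module
  rw [e, hx, hy] at h
  have h2 : (12/25 : ℝ) • (A * B + B * A) = 0 := by
    have : (9/25 : ℝ) • (1 : Mat 2) + (16/25 : ℝ) • (1 : Mat 2) = 1 := by module
    rw [this] at h
    exact add_eq_left.mp h
  exact (smul_eq_zero.mp h2).resolve_left (by norm_num)

/-- Corollary `nuh`. -/
theorem stmt12 :
    ¬ ∃ φ : Mat 2 → HermS 2, IsLinearMap ℝ φ ∧
      ∀ U : Mat 2, U ∈ Matrix.unitaryGroup (Fin 2) ℂ →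
        (φ U : Mat 2) ∈ Matrix.unitaryGroup (Fin 2) ℂ := by
  rintro ⟨φ, hl, hu⟩
  have hsq : ∀ U : Mat 2, U * Uᴴ = 1 → (φ U : Mat 2) * (φ U : Mat 2) = 1 := by
    intro U hU
    have h := Matrix.mem_unitaryGroup_iff.mp (hu U (Matrix.mem_unitaryGroup_iff.mpr hU))
    have hh : (φ U : Mat 2)ᴴ = φ U := (φ U).2
    rwa [Matrix.star_eq_conjTranspose, hh] at h
  have anti := anti_aux φ hl hsq
  let P : Mat 2 := 1
  let Q : Mat 2 := !![Complex.I, 0; 0, -Complex.I]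
  let R : Mat 2 := !![0, 1; -1, 0]
  let S : Mat 2 := !![0, Complex.I; Complex.I, 0]
  have uP : P * Pᴴ = 1 := by simp [P]
  have uQ : Q * Qᴴ = 1 := by
    ext i j; fin_cases i <;> fin_cases j <;> simp [Q, Matrix.mul_apply, Fin.sum_univ_two]
  have uR : R * Rᴴ = 1 := by
    ext i j; fin_cases i <;> fin_cases j <;> simp [R, Matrix.mul_apply, Fin.sum_univ_two]
  have uS : S * Sᴴ = 1 := by
    ext i j; fin_cases i <;> fin_cases j <;> simp [S, Matrix.mul_apply, Fin.sum_univ_two]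
  refine no_four (φ P) (φ Q) (φ R) (φ S) (hsq _ uP) (hsq _ uQ) (hsq _ uR) (hsq _ uS)
    (anti _ _ uP uQ ?_) (anti _ _ uP uR ?_) (anti _ _ uP uS ?_) (anti _ _ uQ uR ?_)
    (anti _ _ uQ uS ?_) (anti _ _ uR uS ?_) <;>
  · ext i j
    fin_cases i <;> fin_cases j <;> simp [P, Q, R, S, Matrix.vecMul, dotProduct, Fin.sum_univ_two]
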